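/- Let m, n, p, q be natural numbers with m ≤ n. Let H00, H01, H10, H11 be real matrices of sizes p×p, p×q, q×p, q×q respectively. Let A be a real m×n matrix admitting a singular value decomposition A = Q · S · Rᵀ, where Q is an m×m orthogonal matrix, R is an n×n orthogonal matrix, σ : Fin m → ℝ, and S is the m×n matrix whose (i,j) entry is σ i if the indices i and j are equal as natural numbers and 0 otherwise. Then the characteristic polynomial of the (m·p+n·q)×(m·p+n·q) block matrix [[I_m ⊗ H00, A ⊗ H01], [Aᵀ ⊗ H10, I_n ⊗ H11]] equals (∏_{j : Fin m} charpoly(H↑(σ j))) · (charpoly(H11))^(n−m). -/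

import Mathlib

open Matrix Polynomial Kronecker

theorem charpoly_blockDiag_aux {o l : Type*} [Fintype o] [DecidableEq o] [Fintype l]
    [DecidableEq l] (M : o → Matrix l l ℝ) :
    (Matrix.blockDiagonal M).charpoly = ∏ i, (M i).charpoly := by
  have h : (Matrix.blockDiagonal M).charmatrix
      = Matrix.blockDiagonal (fun i => (M i).charmatrix) := by
    ext1 ⟨a, i⟩ ⟨b, j⟩
    by_cases hij : i = j
    · subst hij
      by_cases hab : a = b
      · subst hab; simp [Matrix.charmatrix_apply, Matrix.blockDiagonal_apply]
      · simp [Matrix.charmatrix_apply, Matrix.blockDiagonal_apply, hab]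
    · simp [Matrix.charmatrix_apply, Matrix.blockDiagonal_apply, hij]
  rw [Matrix.charpoly, h, Matrix.det_blockDiagonal]
  rfl

def shuffleAux (a b c d : Type*) :
    (a × c) ⊕ ((a ⊕ b) × d) ≃ ((c ⊕ d) × a) ⊕ (d × b) where
  toFun
    | Sum.inl (i, x) => Sum.inl (Sum.inl x, i)
    | Sum.inr (Sum.inl i, y) => Sum.inl (Sum.inr y, i)
    | Sum.inr (Sum.inr j, y) => Sum.inr (y, j)
  invFun
    | Sum.inl (Sum.inl x, i) => Sum.inl (i, x)
    | Sum.inl (Sum.inr y, i) => Sum.inr (Sum.inl i, y)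
    | Sum.inr (y, j) => Sum.inr (Sum.inr j, y)
  left_inv := by rintro (⟨i, x⟩ | ⟨i | j, y⟩) <;> rfl
  right_inv := by rintro (⟨x | y, i⟩ | ⟨y, j⟩) <;> rfl

theorem charpoly_conj_aux {m n p q : ℕ}
    (H00 : Matrix (Fin p) (Fin p) ℝ) (H01 : Matrix (Fin p) (Fin q) ℝ)
    (H10 : Matrix (Fin q) (Fin p) ℝ) (H11 : Matrix (Fin q) (Fin q) ℝ)
    (Q : Matrix (Fin m) (Fin m) ℝ) (R : Matrix (Fin n) (Fin n) ℝ)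
    (S : Matrix (Fin m) (Fin n) ℝ)
    (hQ : Qᵀ * Q = 1) (hR : Rᵀ * R = 1) :
    (Matrix.fromBlocks ((1 : Matrix (Fin m) (Fin m) ℝ) ⊗ₖ H00) ((Q * S * Rᵀ) ⊗ₖ H01)
        ((Q * S * Rᵀ)ᵀ ⊗ₖ H10) ((1 : Matrix (Fin n) (Fin n) ℝ) ⊗ₖ H11)).charpoly =
    (Matrix.fromBlocks ((1 : Matrix (Fin m) (Fin m) ℝ) ⊗ₖ H00) (S ⊗ₖ H01)
        (Sᵀ ⊗ₖ H10) ((1 : Matrix (Fin n) (Fin n) ℝ) ⊗ₖ H11)).charpoly := by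
  have hQ' : Q * Qᵀ = 1 := mul_eq_one_comm.mp hQ
  have hR' : R * Rᵀ = 1 := mul_eq_one_comm.mp hR
  set N := Matrix.fromBlocks ((1 : Matrix (Fin m) (Fin m) ℝ) ⊗ₖ H00) (S ⊗ₖ H01)
        (Sᵀ ⊗ₖ H10) ((1 : Matrix (Fin n) (Fin n) ℝ) ⊗ₖ H11) with hN
  let U := Matrix.fromBlocks (Q ⊗ₖ (1 : Matrix (Fin p) (Fin p) ℝ)) 0 0
    (R ⊗ₖ (1 : Matrix (Fin q) (Fin q) ℝ))
  let V := Matrix.fromBlocks (Qᵀ ⊗ₖ (1 : Matrix (Fin p) (Fin p) ℝ)) 0 0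
    (Rᵀ ⊗ₖ (1 : Matrix (Fin q) (Fin q) ℝ))
  have hVU : V * U = 1 := by
    simp [U, V, Matrix.fromBlocks_multiply, ← Matrix.mul_kronecker_mul, hQ, hR]
  have hM : Matrix.fromBlocks ((1 : Matrix (Fin m) (Fin m) ℝ) ⊗ₖ H00) ((Q * S * Rᵀ) ⊗ₖ H01)
        ((Q * S * Rᵀ)ᵀ ⊗ₖ H10) ((1 : Matrix (Fin n) (Fin n) ℝ) ⊗ₖ H11) = U * (N * V) := by
    simp [U, V, hN, Matrix.fromBlocks_multiply, ← Matrix.mul_kronecker_mul, hQ', hR',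
      Matrix.mul_assoc]
  rw [hM, Matrix.charpoly_mul_comm, Matrix.mul_assoc, hVU, Matrix.mul_one]

theorem stmt1 (m n p q : ℕ) (hmn : m ≤ n)
    (H00 : Matrix (Fin p) (Fin p) ℝ) (H01 : Matrix (Fin p) (Fin q) ℝ)
    (H10 : Matrix (Fin q) (Fin p) ℝ) (H11 : Matrix (Fin q) (Fin q) ℝ)
    (A : Matrix (Fin m) (Fin n) ℝ)
    (Q : Matrix (Fin m) (Fin m) ℝ) (R : Matrix (Fin n) (Fin n) ℝ)
    (σ : Fin m → ℝ) (S : Matrix (Fin m) (Fin n) ℝ)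
    (hQ : Qᵀ * Q = 1) (hR : Rᵀ * R = 1)
    (hS : ∀ (i : Fin m) (j : Fin n), S i j = if (i : ℕ) = (j : ℕ) then σ i else 0)
    (hA : A = Q * S * Rᵀ) :
    (Matrix.fromBlocks ((1 : Matrix (Fin m) (Fin m) ℝ) ⊗ₖ H00) (A ⊗ₖ H01)
        (Aᵀ ⊗ₖ H10) ((1 : Matrix (Fin n) (Fin n) ℝ) ⊗ₖ H11)).charpoly =
      (∏ j : Fin m,
        (Matrix.fromBlocks H00 (σ j • H01) (σ j • H10) H11).charpoly) *
        H11.charpoly ^ (n - m) := by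
  subst hA
  rw [charpoly_conj_aux H00 H01 H10 H11 Q R S hQ hR]
  obtain ⟨k, rfl⟩ := Nat.exists_eq_add_of_le hmn
  let e : (Fin m × Fin p) ⊕ (Fin (m + k) × Fin q) ≃
      ((Fin p ⊕ Fin q) × Fin m) ⊕ (Fin q × Fin k) :=
    (Equiv.sumCongr (Equiv.refl _)
      (Equiv.prodCongr finSumFinEquiv.symm (Equiv.refl _))).trans
      (shuffleAux (Fin m) (Fin k) (Fin p) (Fin q))
  rw [← Matrix.charpoly_reindex e]
  have key : Matrix.reindex e e
      (Matrix.fromBlocks ((1 : Matrix (Fin m) (Fin m) ℝ) ⊗ₖ H00) (S ⊗ₖ H01)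
        (Sᵀ ⊗ₖ H10) ((1 : Matrix (Fin (m + k)) (Fin (m + k)) ℝ) ⊗ₖ H11)) =
      Matrix.fromBlocks
        (Matrix.blockDiagonal fun j => Matrix.fromBlocks H00 (σ j • H01) (σ j • H10) H11) 0 0
        (Matrix.blockDiagonal fun _ : Fin k => H11) := by
    ext1 a b
    have hlt : ∀ (i : Fin m) (j : Fin k), (i : ℕ) ≠ m + (j : ℕ) := fun i j => by
      have := i.2
      omega
    have hne : ∀ (i : Fin m) (j : Fin k), Fin.castAdd k i ≠ Fin.natAdd m j := fun i j h =>
      hlt i j (by simpa using congrArg Fin.val h)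
    rcases a with ⟨x | y, i⟩ | ⟨y, j⟩ <;> rcases b with ⟨x' | y', i'⟩ | ⟨y', j'⟩ <;>
      simp [e, shuffleAux, Matrix.blockDiagonal_apply, hS, Matrix.one_apply, hlt, hne,
        (hne _ _).symm, Fin.val_inj] <;> grind
  rw [key, Matrix.charpoly_fromBlocks_zero₁₂, charpoly_blockDiag_aux, charpoly_blockDiag_aux]
  simp
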